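/- arXiv:1608.08942 — 2 statements merged into one kernel-verified Lean document; each statement's English description precedes it below -/
import Mathlib

section
/- Let J be a Cartwright-Sturmfels* ideal of S. Then for general scalars λ_{ij} ∈ K, the sequence Λ = {x_{ij} − λ_{ij}x_{i1} : 1 ≤ i ≤ v, 2 ≤ j ≤ n_i} is a regular sequence on S/J. -/
open MvPolynomial

noncomputable section

namespace CSPaper

/-- The set of variables of the standard `ℤ^v`-graded polynomial ring `S`:
the variable `x_{i j}` of the paper (with `1 ≤ i ≤ v`, `1 ≤ j ≤ n_i`) corresponds to
`⟨i-1, j-1⟩ : MVar v n` where `n (i-1) = n_i - 1`; thus row `i` has `n i + 1 > 0`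
variables and the first variable `x_{i 1}` of row `i` corresponds to `⟨i, 0⟩`. -/
abbrev MVar (v : ℕ) (n : Fin v → ℕ) : Type := Σ i : Fin v, Fin (n i + 1)

/-- The weight function giving the standard `ℤ^v`-grading: `deg (x_{i j}) = e_i ∈ ℤ^v`. -/
def wt (v : ℕ) (n : Fin v → ℕ) : MVar v n → (Fin v → ℕ) := fun p => Pi.single p.1 1

variable {K : Type} [Field K] {v : ℕ} {n : Fin v → ℕ}

/-- An ideal of `S` is `ℤ^v`-graded (multigraded) iff it contains every multihomogeneous
component of each of its elements. -/
def IsMultigraded (I : Ideal (MvPolynomial (MVar v n) K)) : Prop :=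
  ∀ f ∈ I, ∀ a : Fin v → ℕ, weightedHomogeneousComponent (wt v n) a f ∈ I

/-- The value of the `ℤ^v`-graded Hilbert function of the ideal `I` at `a ∈ ℕ^v`:
`dim_K I_a`. -/
def hilb (I : Ideal (MvPolynomial (MVar v n) K)) (a : Fin v → ℕ) : ℕ :=
  Module.finrank K
    ((Submodule.restrictScalars K I ⊓ weightedHomogeneousSubmodule K (wt v n) a :
      Submodule K (MvPolynomial (MVar v n) K)))

/-- Two ideals have the same `ℤ^v`-graded Hilbert series. -/
def sameHS (I J : Ideal (MvPolynomial (MVar v n) K)) : Prop :=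
  ∀ a : Fin v → ℕ, hilb I a = hilb J a

/-- The `ℤ^v`-graded `K`-algebra endomorphism of `S` determined by a `v`-tuple of square
matrices: `x_{i j} ↦ ∑_k (g i)_{k j} x_{i k}`.  For invertible `g i` these are exactly the
elements of `G = GL_{n_1}(K) × ⋯ × GL_{n_v}(K)` acting on `S`. -/
def gAct (g : ∀ i : Fin v, Matrix (Fin (n i + 1)) (Fin (n i + 1)) K) :
    MvPolynomial (MVar v n) K →ₐ[K] MvPolynomial (MVar v n) K :=
  aeval fun p : MVar v n => ∑ k : Fin (n p.1 + 1), C (g p.1 k p.2) * X ⟨p.1, k⟩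

/-- A property `P` of `v`-tuples of matrices holds generically (i.e. for a general
`g ∈ GL_{n_1}(K) × ⋯ × GL_{n_v}(K)`) if there is a nonzero polynomial `h` in the matrix
entries such that `P g` holds for every invertible `g` with `h(g) ≠ 0`. -/
def Generically
    (P : (∀ i : Fin v, Matrix (Fin (n i + 1)) (Fin (n i + 1)) K) → Prop) : Prop :=
  ∃ h : MvPolynomial (Σ i : Fin v, Fin (n i + 1) × Fin (n i + 1)) K, h ≠ 0 ∧
    ∀ g : ∀ i : Fin v, Matrix (Fin (n i + 1)) (Fin (n i + 1)) K,
      (∀ i, IsUnit (g i).det) →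
      eval (fun q : Σ i : Fin v, Fin (n i + 1) × Fin (n i + 1) => g q.1 q.2.1 q.2.2) h ≠ 0 →
      P g

/-- The leading exponent (exponent of the leading monomial) of a polynomial with respect to
a term order `τ` (a `MonomialOrder`); by convention `leadExp τ 0 = 0`. -/
def leadExp (τ : MonomialOrder (MVar v n)) (f : MvPolynomial (MVar v n) K) :
    MVar v n →₀ ℕ :=
  τ.toSyn.symm (f.support.sup τ.toSyn)

/-- The initial ideal `in_τ(I)`: the monomial ideal generated by the leading monomials of the
nonzero elements of `I`. -/
def inIdeal (τ : MonomialOrder (MVar v n)) (I : Ideal (MvPolynomial (MVar v n) K)) :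
    Ideal (MvPolynomial (MVar v n) K) :=
  Ideal.span {m | ∃ f ∈ I, f ≠ 0 ∧ m = monomial (leadExp τ f) (1 : K)}

/-- `G` is a Gröbner basis of `I` with respect to the term order `τ`. -/
def IsGroebnerBasis (τ : MonomialOrder (MVar v n)) (G : Set (MvPolynomial (MVar v n) K))
    (I : Ideal (MvPolynomial (MVar v n) K)) : Prop :=
  G ⊆ (I : Set (MvPolynomial (MVar v n) K)) ∧
    Ideal.span ((fun f => monomial (leadExp τ f) (1 : K)) '' {f ∈ G | f ≠ 0}) = inIdeal τ I

/-- `J = gin_τ(I)`, the `ℤ^v`-graded generic initial ideal: for a general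
`g ∈ GL_{n_1}(K) × ⋯ × GL_{n_v}(K)` one has `in_τ(g(I)) = J`. -/
def IsGin (τ : MonomialOrder (MVar v n)) (I J : Ideal (MvPolynomial (MVar v n) K)) : Prop :=
  Generically fun g => inIdeal τ (Ideal.map (gAct g) I) = J

/-- A term order such that `x_{i j} > x_{i k}` whenever `j < k`. -/
def RespectsVarOrder (τ : MonomialOrder (MVar v n)) : Prop :=
  ∀ (i : Fin v) (j k : Fin (n i + 1)), j < k →
    τ.toSyn (Finsupp.single (⟨i, k⟩ : MVar v n) 1) <
      τ.toSyn (Finsupp.single (⟨i, j⟩ : MVar v n) 1)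

/-- An ideal is Borel fixed if it is fixed by every element of the Borel subgroup
`B = B_{n_1}(K) × ⋯ × B_{n_v}(K)` of upper triangular invertible matrices (upper triangular
with respect to the order `x_{i 1} > x_{i 2} > ⋯` of the variables in each row). -/
def BorelFixed (I : Ideal (MvPolynomial (MVar v n) K)) : Prop :=
  ∀ g : ∀ i : Fin v, Matrix (Fin (n i + 1)) (Fin (n i + 1)) K,
    (∀ i, IsUnit (g i).det) →
    (∀ (i : Fin v) (k j : Fin (n i + 1)), j < k → g i k j = 0) →
    Ideal.map (gAct g) I = I

/-- A Cartwright-Sturmfels ideal: a `ℤ^v`-graded ideal with the same `ℤ^v`-graded Hilbert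
series as some radical Borel fixed ideal. -/
def IsCS (I : Ideal (MvPolynomial (MVar v n) K)) : Prop :=
  IsMultigraded I ∧ ∃ J : Ideal (MvPolynomial (MVar v n) K),
    J.IsRadical ∧ BorelFixed J ∧ sameHS I J

/-- The exponent of the monomial `x_{1 1}^{a 1} ⋯ x_{v 1}^{a v}` of
`T = K[x_{1 1}, …, x_{v 1}] ⊆ S`. -/
def Tmono (v : ℕ) (n : Fin v → ℕ) (a : Fin v → ℕ) : MVar v n →₀ ℕ :=
  ∑ i : Fin v, Finsupp.single (⟨i, 0⟩ : MVar v n) (a i)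

/-- A `ℤ^v`-graded ideal of `S` extended from `T`, i.e. generated by monomials in the
variables `x_{1 1}, …, x_{v 1}`. -/
def ExtendedFromT (J : Ideal (MvPolynomial (MVar v n) K)) : Prop :=
  ∃ A : Set (Fin v → ℕ),
    J = Ideal.span ((fun a => monomial (Tmono v n a) (1 : K)) '' A)

/-- A Cartwright-Sturmfels* ideal: a `ℤ^v`-graded ideal with the same `ℤ^v`-graded Hilbert
series as some ideal extended from `T`. -/
def IsCSstar (J : Ideal (MvPolynomial (MVar v n) K)) : Prop :=
  IsMultigraded J ∧ ∃ C : Ideal (MvPolynomial (MVar v n) K), ExtendedFromT C ∧ sameHS J C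

/-- A monomial ideal. -/
def IsMonomialIdeal (I : Ideal (MvPolynomial (MVar v n) K)) : Prop :=
  ∃ A : Set (MVar v n →₀ ℕ), I = Ideal.span ((fun s => monomial s (1 : K)) '' A)

/-- A squarefree monomial ideal. -/
def IsSqfreeMonomialIdeal (I : Ideal (MvPolynomial (MVar v n) K)) : Prop :=
  ∃ A : Set (MVar v n →₀ ℕ), (∀ s ∈ A, ∀ x, s x ≤ 1) ∧
    I = Ideal.span ((fun s => monomial s (1 : K)) '' A)

/-- `J` is the Alexander dual of the squarefree monomial ideal `I`: `J` is generated by the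
products `∏_{x ∈ P} x` as `P` ranges over the minimal primes of `I`. -/
def IsAlexanderDual (I J : Ideal (MvPolynomial (MVar v n) K)) : Prop :=
  J = Ideal.span {m | ∃ F : Finset (MVar v n),
    Ideal.span ((fun x => (X x : MvPolynomial (MVar v n) K)) '' ↑F) ∈ I.minimalPrimes ∧
    m = ∏ x ∈ F, X x}

/-- The sequence `x_{i j} - λ_{i j} x_{i 1}`, `1 ≤ i ≤ v`, `2 ≤ j ≤ n_i`, as a list. -/
def LamList (lam : MVar v n → K) : List (MvPolynomial (MVar v n) K) :=
  (List.finRange v).flatMap fun i =>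
    ((List.finRange (n i + 1)).drop 1).map fun j =>
      X (⟨i, j⟩ : MVar v n) - C (lam ⟨i, j⟩) * X (⟨i, 0⟩ : MVar v n)

/-- A property of the scalars `λ = (λ_{i j})` holds for general `λ ∈ K^N` if there is a
nonzero polynomial `h` in the `λ_{i j}` such that the property holds whenever `h(λ) ≠ 0`. -/
def GenericallyLam {v : ℕ} {n : Fin v → ℕ} (K : Type) [Field K]
    (P : (MVar v n → K) → Prop) : Prop :=
  ∃ h : MvPolynomial (MVar v n) K, h ≠ 0 ∧
    ∀ lam : MVar v n → K, eval lam h ≠ 0 → P lam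

variable {K : Type} [Field K] {v : ℕ} {n : Fin v → ℕ}

/-- A graded free resolution of an ideal `I` of a polynomial ring graded by an additive
monoid `M` via a weight function `w` on the variables:
`⋯ → F_2 → F_1 → F_0 → I → 0`, where `F_p` is the free module with (finite) basis `ι p`,
the basis element `i : ι p` having degree `deg p i ∈ M`, all maps are graded of degree `0`,
and the complex is exact. -/
structure GradedFreeResolution (σ : Type) (K : Type) [Field K] (M : Type) [AddCommMonoid M]
    (w : σ → M) (I : Ideal (MvPolynomial σ K)) where
  ι : ℕ → Type
  finite : ∀ p, Finite (ι p)
  deg : ∀ p, ι p → M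
  aug : (ι 0 →₀ MvPolynomial σ K) →ₗ[MvPolynomial σ K] MvPolynomial σ K
  d : ∀ p, (ι (p + 1) →₀ MvPolynomial σ K) →ₗ[MvPolynomial σ K] (ι p →₀ MvPolynomial σ K)
  aug_graded : ∀ i : ι 0, (aug (Finsupp.single i 1)).IsWeightedHomogeneous w (deg 0 i)
  d_graded : ∀ (p : ℕ) (i : ι (p + 1)) (j : ι p),
    (d p (Finsupp.single i 1)) j = 0 ∨
      ∃ b, ((d p (Finsupp.single i 1)) j).IsWeightedHomogeneous w b ∧
        b + deg p j = deg (p + 1) i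
  range_aug : LinearMap.range aug = (I : Submodule (MvPolynomial σ K) (MvPolynomial σ K))
  exact_zero : LinearMap.ker aug = LinearMap.range (d 0)
  exact : ∀ p, LinearMap.ker (d p) = LinearMap.range (d (p + 1))

/-- A graded free resolution is minimal if all entries of the matrices of the differentials
between free modules lie in the irrelevant maximal ideal, i.e. have zero constant term. -/
def GradedFreeResolution.Minimal {σ M : Type} [AddCommMonoid M] {w : σ → M}
    {I : Ideal (MvPolynomial σ K)} (F : GradedFreeResolution σ K M w I) : Prop :=
  ∀ (p : ℕ) (i : F.ι (p + 1)) (j : F.ι p),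
    MvPolynomial.constantCoeff ((F.d p (Finsupp.single i 1)) j) = 0

/-- The graded Betti number `β_{p,a}` read off from a (minimal) graded free resolution:
the number of basis elements of `F_p` of degree `a`. -/
def GradedFreeResolution.betti {σ M : Type} [AddCommMonoid M] {w : σ → M}
    {I : Ideal (MvPolynomial σ K)} (F : GradedFreeResolution σ K M w I) (p : ℕ) (a : M) :
    ℕ :=
  Nat.card {i : F.ι p // F.deg p i = a}

/-- The set of `t × t` minors of the matrix `A`. -/
def minorsSet {R : Type} [CommRing R] (t : ℕ) {m N : ℕ} (A : Matrix (Fin m) (Fin N) R) :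
    Set R :=
  {d | ∃ (r : Fin t → Fin m) (c : Fin t → Fin N),
    Function.Injective r ∧ Function.Injective c ∧ d = (A.submatrix r c).det}

/-- `I_t(A)`, the ideal generated by the `t × t` minors of `A`. -/
def minorsIdeal {R : Type} [CommRing R] (t : ℕ) {m N : ℕ}
    (A : Matrix (Fin m) (Fin N) R) : Ideal R :=
  Ideal.span (minorsSet t A)

/-- `A` is column-graded: `N ≤ v` and each entry of the `j`-th column is either `0` or
multihomogeneous of degree `e_j ∈ ℤ^v`. -/
def ColumnGraded {m N : ℕ} (A : Matrix (Fin m) (Fin N) (MvPolynomial (MVar v n) K)) :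
    Prop :=
  ∃ h : N ≤ v, ∀ i j, A i j = 0 ∨
    (A i j).IsWeightedHomogeneous (wt v n) (Pi.single (Fin.castLE h j) 1)

/-- `A` is row-graded: `m ≤ v` and each entry of the `i`-th row is either `0` or
multihomogeneous of degree `e_i ∈ ℤ^v`. -/
def RowGraded {m N : ℕ} (A : Matrix (Fin m) (Fin N) (MvPolynomial (MVar v n) K)) : Prop :=
  ∃ h : m ≤ v, ∀ i j, A i j = 0 ∨
    (A i j).IsWeightedHomogeneous (wt v n) (Pi.single (Fin.castLE h i) 1)

/-- The exponent of the polarization of the monomial `x_{1 1}^{a 1} ⋯ x_{v 1}^{a v}` of `T`: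
the squarefree monomial `∏_i x_{i 1} x_{i 2} ⋯ x_{i (a i)}`. -/
def polExp (v : ℕ) (n : Fin v → ℕ) (a : Fin v → ℕ) : MVar v n →₀ ℕ :=
  ∑ i : Fin v, ∑ j ∈ Finset.univ.filter (fun j : Fin (n i + 1) => (j : ℕ) < a i),
    Finsupp.single (⟨i, j⟩ : MVar v n) 1

/-- `P = pol(C)`, the polarization of an ideal `C` extended from `T`
(the exponents of the generators of `C` must fit inside `S`). -/
def IsPolarizationOfT (C P : Ideal (MvPolynomial (MVar v n) K)) : Prop :=
  ∃ A : Set (Fin v → ℕ), (∀ a ∈ A, ∀ i, a i ≤ n i + 1) ∧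
    C = Ideal.span ((fun a => monomial (Tmono v n a) (1 : K)) '' A) ∧
    P = Ideal.span ((fun a => monomial (polExp v n a) (1 : K)) '' A)

/-- `ψ` is an identification of the quotient of `S` by the `ℤ^v`-graded ideal `Q` with a
standard `ℤ^v`-graded polynomial ring, compatible with the gradings. -/
def IsGradedStructureIso {n₂ : Fin v → ℕ} (Q : Ideal (MvPolynomial (MVar v n) K))
    (ψ : (MvPolynomial (MVar v n) K ⧸ Q) ≃ₐ[K] MvPolynomial (MVar v n₂) K) : Prop :=
  ∀ (f : MvPolynomial (MVar v n) K) (a : Fin v → ℕ),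
    f.IsWeightedHomogeneous (wt v n) a →
      (ψ (Ideal.Quotient.mk Q f)).IsWeightedHomogeneous (wt v n₂) a

end CSPaper

open CSPaper

section Lifts

variable {K : Type} [Field K] {v : ℕ} {n : Fin v → ℕ}

/-- The exponents of the first variables of each row in a monomial of `S`. -/
def firstExp (s : MVar v n →₀ ℕ) : Fin v → ℕ := fun i => s ⟨i, 0⟩

/-- The linear form `x_{i j} - λ_{i j} x_{i 1}`. -/
def linForm (lam : MVar v n → K) (q : MVar v n) : MvPolynomial (MVar v n) K :=
  X q - C (lam q) * X (⟨q.1, 0⟩ : MVar v n)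

/-- The point with coordinates `x_{i 1} = 1` and `x_{i j} = λ_{i j}` for `j ≥ 2`. -/
def dehomPoint (lam : MVar v n → K) (q : MVar v n) : K := if q.2 = 0 then 1 else lam q

/-- The `K`-linear map sending the monomial `x_1^a y^b`, where `y` denotes the variables outside
the first column, to `F a` times the corresponding product of powers of linear forms. -/
def twist (lam : MVar v n → K) (F : (Fin v → ℕ) → MvPolynomial (MVar v n) K) :
    MvPolynomial (MVar v n) K →ₗ[K] MvPolynomial (MVar v n) K :=
  (basisMonomials (MVar v n) K).constr K fun s =>
    F (firstExp s) * ∏ q : MVar v n, if q.2 = 0 then 1 else linForm lam q ^ s q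

theorem twist_monomial (lam : MVar v n → K) (F : (Fin v → ℕ) → MvPolynomial (MVar v n) K)
    (s : MVar v n →₀ ℕ) :
    twist lam F (monomial s 1) =
      F (firstExp s) * ∏ q : MVar v n, if q.2 = 0 then 1 else linForm lam q ^ s q := by
  have := (basisMonomials (MVar v n) K).constr_basis K (fun s =>
    F (firstExp s) * ∏ q : MVar v n, if q.2 = 0 then 1 else linForm lam q ^ s q) s
  rwa [coe_basisMonomials] at this

theorem monomial_eq_smul_one {σ : Type*} (s : σ →₀ ℕ) (c : K) :
    (monomial s c : MvPolynomial σ K) = c • monomial s 1 := by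
  rw [smul_monomial, smul_eq_mul, mul_one]

theorem mem_of_monomial_mem {σ : Type*} (N : Submodule K (MvPolynomial σ K))
    (f : MvPolynomial σ K) (h : ∀ s ∈ f.support, monomial s (1 : K) ∈ N) : f ∈ N := by
  rw [f.as_sum]
  refine Submodule.sum_mem _ fun s hs => ?_
  rw [monomial_eq_smul_one]
  exact N.smul_mem _ (h s hs)

theorem firstExp_single_add {q : MVar v n} (hq : q.2 ≠ 0) (s : MVar v n →₀ ℕ) :
    firstExp (Finsupp.single q 1 + s) = firstExp s := by
  funext i
  have : q ≠ ⟨i, 0⟩ := by rintro rfl; exact hq rfl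
  simp [firstExp, this]

theorem twist_X_mul (lam : MVar v n → K) (F : (Fin v → ℕ) → MvPolynomial (MVar v n) K)
    {q : MVar v n} (hq : q.2 ≠ 0) (f : MvPolynomial (MVar v n) K) :
    twist lam F (X q * f) = linForm lam q * twist lam F f := by
  have key : twist lam F ∘ₗ LinearMap.mulLeft K (X q) =
      LinearMap.mulLeft K (linForm lam q) ∘ₗ twist lam F := by
    refine (basisMonomials (MVar v n) K).ext fun s => ?_
    simp only [coe_basisMonomials, LinearMap.comp_apply, LinearMap.mulLeft_apply]
    rw [X, monomial_mul, one_mul, twist_monomial, twist_monomial, firstExp_single_add hq,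
      mul_left_comm]
    congr 1
    rw [← Finset.mul_prod_erase _ _ (Finset.mem_univ q),
      ← Finset.mul_prod_erase Finset.univ (fun p : MVar v n =>
        if p.2 = 0 then 1 else linForm lam p ^ s p) (Finset.mem_univ q), ← mul_assoc]
    congr 1
    · simp [hq, pow_add]
    · refine Finset.prod_congr rfl fun p hp => ?_
      have : q ≠ p := (Finset.ne_of_mem_erase hp).symm
      simp [this]
  exact LinearMap.congr_fun key f

theorem isWeightedHomogeneous_linForm (lam : MVar v n → K) (q : MVar v n) :
    (linForm lam q).IsWeightedHomogeneous (wt v n) (wt v n q) :=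
  (isWeightedHomogeneous_X K (wt v n) q).sub
    ((isWeightedHomogeneous_X K (wt v n) (⟨q.1, 0⟩ : MVar v n)).C_mul (lam q))

theorem weight_wt_apply (s : MVar v n →₀ ℕ) (i : Fin v) :
    Finsupp.weight (wt v n) s i = ∑ j : Fin (n i + 1), s ⟨i, j⟩ := by
  rw [Finsupp.weight_apply, Finsupp.sum_fintype _ _ (by simp), Fintype.sum_sigma,
    Finset.sum_apply]
  rw [Finset.sum_eq_single i]
  · simp [wt]
  · intro b _ hb
    simp [wt, hb.symm]
  · simp

theorem weight_eq_firstExp_add (s : MVar v n →₀ ℕ) :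
    Finsupp.weight (wt v n) s =
      firstExp s + ∑ q : MVar v n, if q.2 = 0 then 0 else s q • wt v n q := by
  rw [Finsupp.weight_apply, Finsupp.sum_fintype _ _ (by simp)]
  have : firstExp s = ∑ q : MVar v n, if q.2 = 0 then s q • wt v n q else 0 := by
    rw [Fintype.sum_sigma]
    funext i
    rw [Finset.sum_apply, Finset.sum_eq_single i]
    · rw [Finset.sum_apply, Finset.sum_eq_single (0 : Fin (n i + 1))]
      · simp [firstExp, wt]
      · intro j _ hj
        simp [hj]
      · simp
    · intro b _ hb
      simp [wt, ite_apply, hb.symm]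
    · simp
  rw [this, ← Finset.sum_add_distrib]
  refine Finset.sum_congr rfl fun q _ => ?_
  split_ifs <;> simp

theorem isWeightedHomogeneous_twist_monomial (lam : MVar v n → K)
    {F : (Fin v → ℕ) → MvPolynomial (MVar v n) K}
    (hF : ∀ a, (F a).IsWeightedHomogeneous (wt v n) a) (s : MVar v n →₀ ℕ) :
    (twist lam F (monomial s 1)).IsWeightedHomogeneous (wt v n) (Finsupp.weight (wt v n) s) := by
  rw [twist_monomial, weight_eq_firstExp_add]
  refine (hF _).mul (IsWeightedHomogeneous.prod _ _ _ fun q _ => ?_)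
  split_ifs
  · exact isWeightedHomogeneous_one _ _
  · exact (isWeightedHomogeneous_linForm lam q).pow _

theorem twist_weightedHomogeneousComponent (lam : MVar v n → K)
    {F : (Fin v → ℕ) → MvPolynomial (MVar v n) K}
    (hF : ∀ a, (F a).IsWeightedHomogeneous (wt v n) a) (d : Fin v → ℕ)
    (f : MvPolynomial (MVar v n) K) :
    twist lam F (weightedHomogeneousComponent (wt v n) d f) =
      weightedHomogeneousComponent (wt v n) d (twist lam F f) := by
  have key : twist lam F ∘ₗ weightedHomogeneousComponent (wt v n) d =
      weightedHomogeneousComponent (wt v n) d ∘ₗ twist lam F := by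
    refine (basisMonomials (MVar v n) K).ext fun s => ?_
    simp only [coe_basisMonomials, LinearMap.comp_apply]
    rw [weightedHomogeneousComponent_of_mem (isWeightedHomogeneous_twist_monomial lam hF s),
      weightedHomogeneousComponent_of_mem (isWeightedHomogeneous_monomial (wt v n) s 1 rfl)]
    split_ifs <;> simp
  exact LinearMap.congr_fun key f

theorem firstExp_Tmono (a : Fin v → ℕ) : firstExp (Tmono v n a) = a := by
  funext i
  simp [firstExp, Tmono, Finsupp.finsetSum_apply, Finsupp.single_apply, Sigma.ext_iff]
  rw [Finset.sum_eq_single i]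
  · simp
  · intro b _ hb
    simp [hb]
  · simp

theorem Tmono_apply_of_ne {q : MVar v n} (hq : q.2 ≠ 0) (a : Fin v → ℕ) :
    Tmono v n a q = 0 := by
  rw [Tmono, Finsupp.finsetSum_apply]
  refine Finset.sum_eq_zero fun i _ => ?_
  rw [Finsupp.single_apply, if_neg]
  rintro rfl
  exact hq rfl

theorem Tmono_firstExp {s : MVar v n →₀ ℕ} (hs : ∀ q : MVar v n, q.2 ≠ 0 → s q = 0) :
    Tmono v n (firstExp s) = s := by
  ext ⟨i, j⟩
  by_cases hj : j = 0
  · subst hj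
    exact congrFun (firstExp_Tmono (n := n) (firstExp s)) i
  · rw [Tmono_apply_of_ne hj, hs _ hj]

theorem weight_Tmono (a : Fin v → ℕ) : Finsupp.weight (wt v n) (Tmono v n a) = a := by
  rw [weight_eq_firstExp_add, firstExp_Tmono, Finset.sum_eq_zero, add_zero]
  intro q _
  split_ifs with h
  · rfl
  · rw [Tmono_apply_of_ne h, zero_smul]

theorem twist_Tmono (lam : MVar v n → K) (F : (Fin v → ℕ) → MvPolynomial (MVar v n) K)
    (a : Fin v → ℕ) : twist lam F (monomial (Tmono v n a) 1) = F a := by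
  rw [twist_monomial, firstExp_Tmono, Finset.prod_eq_one, mul_one]
  intro q _
  split_ifs with h
  · rfl
  · rw [Tmono_apply_of_ne h, pow_zero]

theorem eval_dehomPoint_Tmono (lam : MVar v n → K) (a : Fin v → ℕ) :
    eval (dehomPoint lam) (monomial (Tmono v n a) (1 : K)) = 1 := by
  rw [eval_monomial, one_mul, Finsupp.prod_fintype _ _ (by simp)]
  refine Finset.prod_eq_one fun q _ => ?_
  by_cases hq : q.2 = 0
  · simp [dehomPoint, hq]
  · rw [Tmono_apply_of_ne hq, pow_zero]

/-- If a `K`-subspace contains the multiples by linear forms `x_{i j} - λ_{i j} x_{i 1}` of all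
monomials of degree less than `d`, then modulo this subspace a monomial of degree `d` is a
multiple of a monomial in the first variables. -/
theorem monomial_sub_mem (lam : MVar v n → K) (N : Submodule K (MvPolynomial (MVar v n) K))
    (d : ℕ)
    (hN : ∀ (t : MVar v n →₀ ℕ) (q : MVar v n), q.2 ≠ 0 → t.degree < d →
      linForm lam q * monomial t 1 ∈ N)
    (m : ℕ) (s : MVar v n →₀ ℕ) (hd : s.degree = d)
    (hm : ∑ q : MVar v n, (if q.2 = 0 then 0 else s q) = m) :
    monomial s (1 : K) - eval (dehomPoint lam) (monomial s (1 : K)) •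
      monomial (Tmono v n (Finsupp.weight (wt v n) s)) 1 ∈ N := by
  induction m generalizing s with
  | zero =>
    have hs : ∀ q : MVar v n, q.2 ≠ 0 → s q = 0 := by
      intro q hq
      have := (Finset.sum_eq_zero_iff.mp hm) q (Finset.mem_univ q)
      simpa [hq] using this
    have hT : s = Tmono v n (firstExp s) := (Tmono_firstExp hs).symm
    have hw : Finsupp.weight (wt v n) s = firstExp s := by
      conv_lhs => rw [hT]
      exact weight_Tmono _
    have he : eval (dehomPoint lam) (monomial s (1 : K)) = 1 := by
      rw [hT, eval_dehomPoint_Tmono]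
    rw [hw, he, one_smul, ← hT, sub_self]
    exact N.zero_mem
  | succ m ih =>
    obtain ⟨q, -, hq⟩ : ∃ q ∈ Finset.univ, (if q.2 = 0 then 0 else s q) ≠ 0 := by
      apply Finset.exists_ne_zero_of_sum_ne_zero
      rw [hm]; exact m.succ_ne_zero
    have hq2 : q.2 ≠ 0 := fun h => hq (if_pos h)
    have hsq : s q ≠ 0 := by simpa [hq2] using hq
    obtain ⟨t, rfl⟩ : ∃ t, s = Finsupp.single q 1 + t := by
      have : Finsupp.single q 1 ≤ s := by
        rw [Finsupp.single_le_iff]; omega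
      exact ⟨s - Finsupp.single q 1, (add_tsub_cancel_of_le this).symm⟩
    have hdt : t.degree + 1 = d := by
      rw [← hd, map_add, Finsupp.degree_single, add_comm]
    have hadd : ∀ p : MVar v n, (∑ r : MVar v n, if r.2 = 0 then 0
        else (Finsupp.single p 1 + t : MVar v n →₀ ℕ) r) =
          (if p.2 = 0 then 0 else 1) + ∑ r : MVar v n, if r.2 = 0 then 0 else t r := by
      intro p
      have : ∀ r : MVar v n, (if r.2 = 0 then 0
          else (Finsupp.single p 1 + t : MVar v n →₀ ℕ) r) =
          (if r = p then (if p.2 = 0 then 0 else 1) else 0) + if r.2 = 0 then 0 else t r := by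
        intro r
        by_cases h : r = p
        · subst h; by_cases h2 : r.2 = 0 <;> simp [h2, add_comm]
        · simp [h]
      rw [Finset.sum_congr rfl fun r _ => this r, Finset.sum_add_distrib,
        Finset.sum_ite_eq' Finset.univ p, if_pos (Finset.mem_univ p)]
    have hq0 := ih (Finsupp.single (⟨q.1, 0⟩ : MVar v n) 1 + t)
      (by rw [map_add, Finsupp.degree_single, ← hdt, add_comm])
      (by
        have h1 := hadd q
        rw [hm, if_neg hq2] at h1
        rw [hadd, if_pos rfl]; omega)
    have hlin := hN t q hq2 (by omega)
    have hw : Finsupp.weight (wt v n) (Finsupp.single (⟨q.1, 0⟩ : MVar v n) 1 + t) =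
        Finsupp.weight (wt v n) (Finsupp.single q 1 + t) := by
      rw [map_add, map_add, Finsupp.weight_single, Finsupp.weight_single]; rfl
    rw [hw] at hq0
    have e1 : ∀ p : MVar v n, monomial (Finsupp.single p 1 + t) (1 : K) =
        X p * monomial t 1 := by
      intro p; rw [X, monomial_mul, one_mul]
    convert N.add_mem hlin (N.smul_mem (lam q) hq0) using 1
    rw [e1, e1, linForm, map_mul, map_mul, eval_X, eval_X]
    simp only [dehomPoint, if_neg hq2, if_true, smul_eq_C_mul, map_mul, C_1]
    ring

theorem monomial_mem_range_twist (lam : MVar v n → K)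
    {F : (Fin v → ℕ) → MvPolynomial (MVar v n) K}
    (hF : ∀ a, (F a).IsWeightedHomogeneous (wt v n) a)
    (hF1 : ∀ a, eval (dehomPoint lam) (F a) = 1) (s : MVar v n →₀ ℕ) :
    monomial s (1 : K) ∈ LinearMap.range (twist lam F) := by
  induction hd : s.degree using Nat.strong_induction_on generalizing s with
  | _ d ih =>
  have key := fun (t : MVar v n →₀ ℕ) (ht : t.degree = d) =>
    monomial_sub_mem lam (LinearMap.range (twist lam F)) d (by
      intro t q hq ht
      obtain ⟨f, hf⟩ := ih _ ht t rfl
      exact ⟨X q * f, by rw [twist_X_mul lam F hq, hf]⟩) _ t ht rfl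
  have hdeg : ∀ t : MVar v n →₀ ℕ, t.degree = ∑ i, Finsupp.weight (wt v n) t i := by
    intro t
    rw [Finsupp.degree_eq_sum, Fintype.sum_sigma]
    exact Finset.sum_congr rfl fun i _ => (weight_wt_apply t i).symm
  set a := Finsupp.weight (wt v n) s with ha
  have hsum : F a - eval (dehomPoint lam) (F a) • monomial (Tmono v n a) 1 ∈
      LinearMap.range (twist lam F) := by
    have : F a - eval (dehomPoint lam) (F a) • monomial (Tmono v n a) 1 =
        ∑ t ∈ (F a).support, (F a).coeff t • (monomial t (1 : K) -
          eval (dehomPoint lam) (monomial t (1 : K)) • monomial (Tmono v n a) 1) := by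
      simp only [smul_sub, Finset.sum_sub_distrib, smul_smul, ← Finset.sum_smul]
      congr 1
      · conv_lhs => rw [(F a).as_sum]
        exact Finset.sum_congr rfl fun t _ => monomial_eq_smul_one _ _
      · congr 1
        conv_lhs => rw [(F a).as_sum, map_sum]
        refine Finset.sum_congr rfl fun t _ => ?_
        rw [eval_monomial, eval_monomial, one_mul]
    rw [this]
    refine Submodule.sum_mem _ fun t ht => Submodule.smul_mem _ _ ?_
    have htw : Finsupp.weight (wt v n) t = a := hF a (mem_support_iff.mp ht)
    have := key t (by rw [← hd, hdeg, hdeg, htw])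
    rwa [htw] at this
  rw [hF1, one_smul] at hsum
  have hT : monomial (Tmono v n a) (1 : K) ∈ LinearMap.range (twist lam F) := by
    have := Submodule.sub_mem _ (LinearMap.mem_range.mpr ⟨_, twist_Tmono lam F a⟩) hsum
    rwa [sub_sub_cancel] at this
  have := Submodule.add_mem _ (key s hd) (Submodule.smul_mem _
    (eval (dehomPoint lam) (monomial s (1 : K))) hT)
  rwa [sub_add_cancel] at this

theorem twist_surjective (lam : MVar v n → K)
    {F : (Fin v → ℕ) → MvPolynomial (MVar v n) K}
    (hF : ∀ a, (F a).IsWeightedHomogeneous (wt v n) a)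
    (hF1 : ∀ a, eval (dehomPoint lam) (F a) = 1) : Function.Surjective (twist lam F) :=
  fun f => mem_of_monomial_mem (LinearMap.range (twist lam F)) f
    fun s _ => monomial_mem_range_twist lam hF hF1 s

instance finiteDimensional_weightedHomogeneousSubmodule (d : Fin v → ℕ) :
    FiniteDimensional K (weightedHomogeneousSubmodule K (wt v n) d) := by
  have hfin : {s : MVar v n →₀ ℕ | Finsupp.weight (wt v n) s = d}.Finite := by
    refine (Set.finite_Iic (Finsupp.equivFunOnFinite.symm
      fun q : MVar v n => d q.1)).subset fun s hs q => ?_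
    have hs' : Finsupp.weight (wt v n) s = d := hs
    have : s q ≤ ∑ j : Fin (n q.1 + 1), s ⟨q.1, j⟩ :=
      Finset.single_le_sum (f := fun j : Fin (n q.1 + 1) => s ⟨q.1, j⟩)
        (fun _ _ => Nat.zero_le _) (Finset.mem_univ q.2)
    rw [← weight_wt_apply, hs'] at this
    exact this
  have hspan : weightedHomogeneousSubmodule K (wt v n) d ≤
      Submodule.span K ((fun s => monomial s (1 : K)) ''
        {s : MVar v n →₀ ℕ | Finsupp.weight (wt v n) s = d}) := by
    intro f hf
    exact mem_of_monomial_mem _ f fun s hs =>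
      Submodule.subset_span ⟨s, hf (mem_support_iff.mp hs), rfl⟩
  have := FiniteDimensional.span_of_finite K (hfin.image fun s => monomial s (1 : K))
  exact Submodule.finiteDimensional_of_le hspan

theorem twist_injective (lam : MVar v n → K)
    {F : (Fin v → ℕ) → MvPolynomial (MVar v n) K}
    (hF : ∀ a, (F a).IsWeightedHomogeneous (wt v n) a)
    (hF1 : ∀ a, eval (dehomPoint lam) (F a) = 1) : Function.Injective (twist lam F) := by
  rw [injective_iff_map_eq_zero]
  intro f hf
  have hcomp : ∀ d, weightedHomogeneousComponent (wt v n) d f = 0 := by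
    intro d
    have hmaps : ∀ g ∈ weightedHomogeneousSubmodule K (wt v n) d,
        twist lam F g ∈ weightedHomogeneousSubmodule K (wt v n) d := by
      intro g hg
      rw [← weightedHomogeneousComponent_eq_self hg, twist_weightedHomogeneousComponent lam hF]
      exact weightedHomogeneousComponent_mem _ _ _
    have hsurj : Function.Surjective ((twist lam F).restrict hmaps) := by
      rintro ⟨g, hg⟩
      obtain ⟨h, rfl⟩ := twist_surjective lam hF hF1 g
      refine ⟨⟨_, weightedHomogeneousComponent_mem (wt v n) h d⟩, Subtype.ext ?_⟩
      rw [LinearMap.restrict_apply]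
      exact (twist_weightedHomogeneousComponent lam hF d h).trans
        (weightedHomogeneousComponent_eq_self hg)
    have hinj := LinearMap.injective_iff_surjective.mpr hsurj
    have := @hinj ⟨_, weightedHomogeneousComponent_mem (wt v n) f d⟩ 0 (Subtype.ext (by
      rw [LinearMap.restrict_apply, map_zero]
      simp [twist_weightedHomogeneousComponent lam hF, hf]))
    exact congrArg Subtype.val this
  rw [← finsum_weightedHomogeneousComponent (wt v n) f, finsum_congr hcomp, finsum_zero]

theorem exists_twist_eq_of_mem (lam : MVar v n → K)
    {F : (Fin v → ℕ) → MvPolynomial (MVar v n) K}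
    (hF : ∀ a, (F a).IsWeightedHomogeneous (wt v n) a)
    (hF1 : ∀ a, eval (dehomPoint lam) (F a) = 1)
    {I J : Ideal (MvPolynomial (MVar v n) K)} (hJ : IsMultigraded J) (hIJ : sameHS J I)
    (hle : ∀ f ∈ I, twist lam F f ∈ J) {f : MvPolynomial (MVar v n) K} (hf : f ∈ J) :
    ∃ g ∈ I, twist lam F g = f := by
  suffices f ∈ (I.restrictScalars K).map (twist lam F) by
    obtain ⟨g, hg, e⟩ := this
    exact ⟨g, hg, e⟩
  rw [← finsum_weightedHomogeneousComponent (wt v n) f]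
  refine finsum_induction (· ∈ (I.restrictScalars K).map (twist lam F))
    (Submodule.zero_mem _) (fun _ _ => Submodule.add_mem _) fun d => ?_
  set W := weightedHomogeneousSubmodule K (wt v n) d
  have hsub : (I.restrictScalars K ⊓ W).map (twist lam F) ≤ J.restrictScalars K ⊓ W := by
    rintro _ ⟨g, ⟨hgI, hgW⟩, rfl⟩
    refine ⟨hle g hgI, ?_⟩
    have hgW' : g ∈ weightedHomogeneousSubmodule K (wt v n) d := hgW
    rw [← weightedHomogeneousComponent_eq_self hgW', twist_weightedHomogeneousComponent lam hF]
    exact weightedHomogeneousComponent_mem _ _ _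
  have : FiniteDimensional K (J.restrictScalars K ⊓ W : Submodule K _) :=
    Submodule.finiteDimensional_of_le (inf_le_right : _ ≤ W)
  have heq := Submodule.eq_of_le_of_finrank_eq hsub (by
    rw [← (Submodule.equivMapOfInjective _ (twist_injective lam hF hF1) _).finrank_eq]
    exact (hIJ d).symm)
  have hmem : weightedHomogeneousComponent (wt v n) d f ∈ J.restrictScalars K ⊓ W :=
    ⟨hJ f hf d, weightedHomogeneousComponent_mem _ _ _⟩
  rw [← heq] at hmem
  exact Submodule.map_mono inf_le_left hmem

/-- A variable outside the first column which is not in `B` is a nonzerodivisor modulo an ideal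
extended from `T` plus the variables in `B`. -/
theorem mem_sup_span_of_X_mul_mem {C : Ideal (MvPolynomial (MVar v n) K)} (hC : ExtendedFromT C)
    (B : Set (MVar v n)) {q : MVar v n} (hq : q.2 ≠ 0) (hqB : q ∉ B)
    {f : MvPolynomial (MVar v n) K}
    (hf : X q * f ∈ C ⊔ Ideal.span (X '' B)) : f ∈ C ⊔ Ideal.span (X '' B) := by
  obtain ⟨A, rfl⟩ := hC
  have hspan : Ideal.span ((fun a => monomial (Tmono v n a) (1 : K)) '' A) ⊔
      Ideal.span (X '' B) = Ideal.span ((fun s => monomial s (1 : K)) ''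
        (Tmono v n '' A ∪ (fun p => Finsupp.single p 1) '' B)) := by
    rw [← Ideal.span_union, Set.image_union, Set.image_image, Set.image_image]
    rfl
  rw [hspan, mem_ideal_span_monomial_image] at hf ⊢
  intro m hm
  obtain ⟨u, hu, hle⟩ := hf (Finsupp.single q 1 + m) (by
    rw [mem_support_iff, coeff_X_mul]
    exact mem_support_iff.mp hm)
  have huq : u q = 0 := by
    rcases hu with ⟨a, -, rfl⟩ | ⟨p, hp, rfl⟩
    · exact Tmono_apply_of_ne hq a
    · have : p ≠ q := by rintro rfl; exact hqB hp
      simp [this]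
  refine ⟨u, hu, fun p => ?_⟩
  by_cases hpq : p = q
  · rw [hpq, huq]; exact Nat.zero_le _
  · simpa [hpq] using hle p

theorem exists_twist_eq_of_mem_span (lam : MVar v n → K)
    {F : (Fin v → ℕ) → MvPolynomial (MVar v n) K}
    (hsurj : Function.Surjective (twist lam F)) {B : Set (MVar v n)}
    (hB : ∀ q ∈ B, q.2 ≠ 0) {f : MvPolynomial (MVar v n) K}
    (hf : f ∈ Ideal.span (linForm lam '' B)) :
    ∃ g ∈ Ideal.span (X '' B : Set (MvPolynomial (MVar v n) K)), twist lam F g = f := by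
  suffices ∀ r : MvPolynomial (MVar v n) K,
      ∃ g ∈ Ideal.span (X '' B : Set (MvPolynomial (MVar v n) K)), twist lam F g = r * f by
    simpa using this 1
  induction hf using Submodule.span_induction with
  | mem f hf =>
    intro r
    obtain ⟨q, hq, rfl⟩ := hf
    obtain ⟨g, hg⟩ := hsurj r
    exact ⟨X q * g, Ideal.mul_mem_right _ _ (Ideal.subset_span ⟨q, hq, rfl⟩),
      by rw [twist_X_mul lam F (hB q hq), hg, mul_comm]⟩
  | zero => exact fun r => ⟨0, Ideal.zero_mem _, by rw [mul_zero, map_zero]⟩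
  | add f₁ f₂ _ _ h₁ h₂ =>
    intro r
    obtain ⟨g₁, hg₁, e₁⟩ := h₁ r
    obtain ⟨g₂, hg₂, e₂⟩ := h₂ r
    exact ⟨g₁ + g₂, Ideal.add_mem _ hg₁ hg₂, by rw [map_add, e₁, e₂, mul_add]⟩
  | smul r' f _ h =>
    intro r
    rw [smul_eq_mul, ← mul_assoc]
    exact h (r * r')

theorem twist_mem_span (lam : MVar v n → K) (F : (Fin v → ℕ) → MvPolynomial (MVar v n) K)
    {B : Set (MVar v n)} (hB : ∀ q ∈ B, q.2 ≠ 0) {f : MvPolynomial (MVar v n) K}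
    (hf : f ∈ Ideal.span (X '' B : Set (MvPolynomial (MVar v n) K))) :
    twist lam F f ∈ Ideal.span (linForm lam '' B) := by
  refine mem_of_monomial_mem
    (((Ideal.span (linForm lam '' B)).restrictScalars K).comap (twist lam F)) f fun s hs => ?_
  obtain ⟨q, hq, hsq⟩ := mem_ideal_span_X_image.mp hf s hs
  have hle : Finsupp.single q 1 ≤ s := by
    rw [Finsupp.single_le_iff]; omega
  have : monomial s (1 : K) = X q * monomial (s - Finsupp.single q 1) 1 := by
    rw [X, monomial_mul, one_mul, add_tsub_cancel_of_le hle]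
  rw [Submodule.mem_comap, this, twist_X_mul lam F (hB q hq)]
  exact Ideal.mul_mem_right _ _ (Ideal.subset_span ⟨q, hq, rfl⟩)

theorem twist_mem_of_mem_span_Tmono (lam : MVar v n → K)
    {F : (Fin v → ℕ) → MvPolynomial (MVar v n) K} {A : Set (Fin v → ℕ)}
    {J : Ideal (MvPolynomial (MVar v n) K)} (hFJ : ∀ a, (∃ b ∈ A, b ≤ a) → F a ∈ J)
    {f : MvPolynomial (MVar v n) K}
    (hf : f ∈ Ideal.span ((fun a => monomial (Tmono v n a) (1 : K)) '' A)) :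
    twist lam F f ∈ J := by
  refine mem_of_monomial_mem ((J.restrictScalars K).comap (twist lam F)) f fun s hs => ?_
  rw [← Set.image_image (fun s => monomial s (1 : K)), mem_ideal_span_monomial_image] at hf
  obtain ⟨_, ⟨a, ha, rfl⟩, hle⟩ := hf s hs
  rw [Submodule.mem_comap, twist_monomial]
  refine Ideal.mul_mem_right _ _ (hFJ _ ⟨a, ha, fun i => ?_⟩)
  rw [← firstExp_Tmono (n := n) a]
  exact hle ⟨i, 0⟩

/-- If `J` contains suitable lifts of the monomials of an ideal extended from `T` with the same
Hilbert series, then the linear forms `x_{i j} - λ_{i j} x_{i 1}` form a regular sequence. -/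
theorem mem_sup_of_linForm_mul_mem (lam : MVar v n → K)
    {F : (Fin v → ℕ) → MvPolynomial (MVar v n) K}
    (hF : ∀ a, (F a).IsWeightedHomogeneous (wt v n) a)
    (hF1 : ∀ a, eval (dehomPoint lam) (F a) = 1) {A : Set (Fin v → ℕ)}
    {J : Ideal (MvPolynomial (MVar v n) K)} (hJ : IsMultigraded J)
    (hHS : sameHS J (Ideal.span ((fun a => monomial (Tmono v n a) (1 : K)) '' A)))
    (hFJ : ∀ a, (∃ b ∈ A, b ≤ a) → F a ∈ J)
    {B : Set (MVar v n)} (hB : ∀ q ∈ B, q.2 ≠ 0) {q : MVar v n} (hq : q.2 ≠ 0) (hqB : q ∉ B)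
    {f : MvPolynomial (MVar v n) K}
    (hf : linForm lam q * f ∈ J ⊔ Ideal.span (linForm lam '' B)) :
    f ∈ J ⊔ Ideal.span (linForm lam '' B) := by
  have hsurj := twist_surjective lam hF hF1
  obtain ⟨s, rfl⟩ := hsurj f
  obtain ⟨j, hj, l, hl, hjl⟩ := Submodule.mem_sup.mp hf
  obtain ⟨c, hc, rfl⟩ := exists_twist_eq_of_mem lam hF hF1 hJ hHS
    (fun f hf => twist_mem_of_mem_span_Tmono lam hFJ hf) hj
  obtain ⟨t, ht, rfl⟩ := exists_twist_eq_of_mem_span lam hsurj hB hl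
  rw [← twist_X_mul lam F hq, ← map_add] at hjl
  have hs := mem_sup_span_of_X_mul_mem ⟨A, rfl⟩ B hq hqB
    (twist_injective lam hF hF1 hjl ▸ Submodule.add_mem_sup hc ht)
  obtain ⟨c', hc', t', ht', rfl⟩ := Submodule.mem_sup.mp hs
  rw [map_add]
  exact Submodule.add_mem_sup (twist_mem_of_mem_span_Tmono lam hFJ hc')
    (twist_mem_span lam F hB ht')

/-- A criterion for weak regularity of a sequence on a quotient ring. -/
theorem isWeaklyRegular_quotient_of_forall {R : Type*} [CommRing R] (J : Ideal R) (rs : List R)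
    (h : ∀ (i : ℕ) (hi : i < rs.length) (f : R),
      rs[i] * f ∈ J ⊔ Ideal.ofList (rs.take i) → f ∈ J ⊔ Ideal.ofList (rs.take i)) :
    RingTheory.Sequence.IsWeaklyRegular (R ⧸ J) rs := by
  refine ⟨fun i hi => ?_⟩
  have hmem : ∀ f : R, Ideal.Quotient.mk J f ∈
      (Ideal.ofList (rs.take i) • ⊤ : Submodule R (R ⧸ J)) ↔
        f ∈ J ⊔ Ideal.ofList (rs.take i) := by
    intro f
    rw [Ideal.smul_top_eq_map, sup_comm, ← Ideal.mem_quotient_iff_mem_sup]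
    rfl
  refine IsSMulRegular.of_right_eq_zero_of_smul fun x hx => ?_
  obtain ⟨y, rfl⟩ := Submodule.Quotient.mk_surjective _ x
  obtain ⟨f, rfl⟩ := Ideal.Quotient.mk_surjective y
  rw [← Submodule.Quotient.mk_smul, Submodule.Quotient.mk_eq_zero] at hx
  rw [Submodule.Quotient.mk_eq_zero, hmem]
  exact h i hi f ((hmem _).mp hx)

theorem LamList_eq_map (lam : MVar v n → K) : LamList lam =
    ((List.finRange v).flatMap fun i => ((List.finRange (n i + 1)).drop 1).map fun j =>
      (⟨i, j⟩ : MVar v n)).map (linForm lam) := by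
  simp only [LamList, List.map_flatMap, List.map_map]
  rfl

theorem snd_ne_zero_of_mem {q : MVar v n} (hq : q ∈ (List.finRange v).flatMap fun i =>
    ((List.finRange (n i + 1)).drop 1).map fun j => (⟨i, j⟩ : MVar v n)) : q.2 ≠ 0 := by
  simp only [List.mem_flatMap, List.mem_map, List.finRange_succ, List.drop_one,
    List.tail_cons] at hq
  obtain ⟨i, -, j, ⟨k, -, rfl⟩, rfl⟩ := hq
  exact Fin.succ_ne_zero k

theorem nodup_flatMap_drop : ((List.finRange v).flatMap fun i =>
    ((List.finRange (n i + 1)).drop 1).map fun j => (⟨i, j⟩ : MVar v n)).Nodup := by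
  rw [List.nodup_flatMap]
  refine ⟨fun i _ => ((List.nodup_finRange _).sublist (List.drop_sublist _ _)).map
    (sigma_mk_injective (β := fun i : Fin v => Fin (n i + 1))), (List.nodup_finRange v).imp fun {i j} hij => ?_⟩
  simp only [Function.onFun, List.disjoint_left, List.mem_map]
  rintro _ ⟨k, -, rfl⟩ ⟨l, -, h⟩
  exact hij (congrArg Sigma.fst h).symm

theorem eval_mul_of_isWeightedHomogeneous {G : MvPolynomial (MVar v n) K} {a : Fin v → ℕ}
    (hG : G.IsWeightedHomogeneous (wt v n) a) (c : Fin v → K) (x : MVar v n → K) :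
    eval (fun q => c q.1 * x q) G = (∏ i, c i ^ a i) * eval x G := by
  rw [eval_eq', eval_eq', Finset.mul_sum]
  refine Finset.sum_congr rfl fun d hd => ?_
  have hw : Finsupp.weight (wt v n) d = a := hG (mem_support_iff.mp hd)
  simp only [mul_pow, Finset.prod_mul_distrib]
  have : ∏ q : MVar v n, c q.1 ^ d q = ∏ i, c i ^ a i := by
    rw [Fintype.prod_sigma]
    refine Finset.prod_congr rfl fun i _ => ?_
    rw [Finset.prod_pow_eq_pow_sum Finset.univ (fun j => d ⟨i, j⟩) (c i), ← weight_wt_apply, hw]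
  rw [this]
  ring

/-- The dehomogenization of `G`, obtained by setting `x_{i 1} = 1` for all `i`. -/
def dehom (G : MvPolynomial (MVar v n) K) : MvPolynomial (MVar v n) K :=
  bind₁ (fun q : MVar v n => if q.2 = 0 then 1 else X q) G

theorem eval_dehom (lam : MVar v n → K) (G : MvPolynomial (MVar v n) K) :
    eval lam (dehom G) = eval (dehomPoint lam) G := by
  rw [dehom, ← coe_aeval_eq_eval, ← coe_aeval_eq_eval, RingHom.coe_coe, RingHom.coe_coe,
    aeval_bind₁]
  congr 2
  funext q
  rw [dehomPoint]
  split_ifs <;> simp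

theorem dehom_ne_zero [Infinite K] {G : MvPolynomial (MVar v n) K} {a : Fin v → ℕ}
    (hG : G.IsWeightedHomogeneous (wt v n) a) (h0 : G ≠ 0) : dehom G ≠ 0 := by
  intro hd
  have hprod : G * ∏ i, X (⟨i, 0⟩ : MVar v n) ≠ 0 :=
    mul_ne_zero h0 (Finset.prod_ne_zero_iff.mpr fun i _ => X_ne_zero _)
  refine hprod (MvPolynomial.funext fun μ => ?_)
  rw [map_mul, map_zero, map_prod]
  by_cases hμ : ∀ i, μ ⟨i, 0⟩ ≠ 0
  · have hpt : μ = fun q : MVar v n =>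
        μ ⟨q.1, 0⟩ * dehomPoint (fun p => (μ ⟨p.1, 0⟩)⁻¹ * μ p) q := by
      funext q
      obtain ⟨i, j⟩ := q
      by_cases hj : j = 0
      · subst hj; simp [dehomPoint]
      · simp [dehomPoint, hj, hμ i]
    rw [hpt, eval_mul_of_isWeightedHomogeneous hG (fun i => μ ⟨i, 0⟩), ← eval_dehom, hd,
      map_zero, mul_zero, zero_mul]
  · push Not at hμ
    obtain ⟨i, hi⟩ := hμ
    rw [Finset.prod_eq_zero (Finset.mem_univ i) (by rw [eval_X, hi]), mul_zero]

theorem exists_ne_zero_mem_of_sameHS {J : Ideal (MvPolynomial (MVar v n) K)}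
    {A : Set (Fin v → ℕ)}
    (hHS : sameHS J (Ideal.span ((fun a => monomial (Tmono v n a) (1 : K)) '' A)))
    {a : Fin v → ℕ} (ha : a ∈ A) :
    ∃ G ∈ J, G ≠ 0 ∧ G.IsWeightedHomogeneous (wt v n) a := by
  by_contra! hcon
  set I := Ideal.span ((fun a => monomial (Tmono v n a) (1 : K)) '' A)
  have hbot : J.restrictScalars K ⊓ weightedHomogeneousSubmodule K (wt v n) a = ⊥ := by
    rw [eq_bot_iff]
    rintro G ⟨hGJ, hGa⟩
    by_contra hG
    exact hcon G hGJ hG hGa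
  have h0 : hilb I a = 0 := by
    rw [← hHS a, hilb, hbot, finrank_bot]
  have : FiniteDimensional K
      (I.restrictScalars K ⊓ weightedHomogeneousSubmodule K (wt v n) a : Submodule K _) :=
    Submodule.finiteDimensional_of_le inf_le_right
  have hmem : monomial (Tmono v n a) (1 : K) ∈
      I.restrictScalars K ⊓ weightedHomogeneousSubmodule K (wt v n) a :=
    ⟨Ideal.subset_span ⟨a, ha, rfl⟩, isWeightedHomogeneous_monomial _ _ _ (weight_Tmono a)⟩
  rw [Submodule.finrank_eq_zero.mp h0, Submodule.mem_bot, monomial_eq_zero] at hmem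
  exact one_ne_zero hmem

theorem exists_finset_forall_exists_le (A : Set (Fin v → ℕ)) :
    ∃ A₀ : Finset (Fin v → ℕ), ↑A₀ ⊆ A ∧ ∀ a ∈ A, ∃ b ∈ A₀, b ≤ a := by
  have hfin : {a | Minimal (· ∈ A) a}.Finite :=
    WellQuasiOrderedLE.finite_of_isAntichain (setOfPred_minimal_antichain _)
  refine ⟨hfin.toFinset, fun a ha => (hfin.mem_toFinset.mp ha).1, fun a ha => ?_⟩
  obtain ⟨b, hba, hb⟩ := exists_minimal_le_of_wellFoundedLT (· ∈ A) a ha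
  exact ⟨b, hfin.mem_toFinset.mpr hb, hba⟩

end Lifts

/-- **Proposition (2) on CS* ideals.** Let `J` be a Cartwright-Sturmfels* ideal of `S`.
Then for general scalars `λ_{i j} ∈ K` the sequence
`Λ = {x_{i j} - λ_{i j} x_{i 1} : 1 ≤ i ≤ v, 2 ≤ j ≤ n_i}` is a regular sequence on
`S/J`. -/
theorem CSstar_generic_regular_sequence
    {K : Type} [Field K] [Infinite K] {v : ℕ} {n : Fin v → ℕ}
    (J : Ideal (MvPolynomial (MVar v n) K)) (hJ : IsCSstar J) :
    GenericallyLam K fun lam : MVar v n → K =>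
      RingTheory.Sequence.IsWeaklyRegular (MvPolynomial (MVar v n) K ⧸ J)
        (LamList lam) := by
  obtain ⟨hJm, _, ⟨A, rfl⟩, hHS⟩ := hJ
  choose! G hGJ hG0 hGa using fun a (ha : a ∈ A) => exists_ne_zero_mem_of_sameHS hHS ha
  obtain ⟨A₀, hA₀, hle⟩ := exists_finset_forall_exists_le A
  refine ⟨∏ a ∈ A₀, dehom (G a), Finset.prod_ne_zero_iff.mpr fun a ha =>
    dehom_ne_zero (hGa a (hA₀ ha)) (hG0 a (hA₀ ha)), fun lam hlam => ?_⟩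
  have hGlam : ∀ a ∈ A₀, eval (dehomPoint lam) (G a) ≠ 0 := by
    rw [map_prod, Finset.prod_ne_zero_iff] at hlam
    exact fun a ha => eval_dehom lam (G a) ▸ hlam a ha
  have hlift : ∀ a : Fin v → ℕ, ∃ F : MvPolynomial (MVar v n) K,
      F.IsWeightedHomogeneous (wt v n) a ∧ eval (dehomPoint lam) F = 1 ∧
        ((∃ b ∈ A, b ≤ a) → F ∈ J) := by
    intro a
    by_cases ha : ∃ b ∈ A, b ≤ a
    · obtain ⟨b, hb, hba⟩ := ha
      obtain ⟨c, hc, hcb⟩ := hle b hb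
      refine ⟨C (eval (dehomPoint lam) (G c))⁻¹ *
        (monomial (Tmono v n (a - c)) 1 * G c), ?_, ?_, fun _ => ?_⟩
      · have := (isWeightedHomogeneous_monomial (wt v n) _ (1 : K)
          (weight_Tmono (n := n) (a - c))).mul (hGa c (hA₀ hc))
        rw [tsub_add_cancel_of_le (hcb.trans hba)] at this
        exact this.C_mul _
      · rw [map_mul, map_mul, eval_C, eval_dehomPoint_Tmono, one_mul,
          inv_mul_cancel₀ (hGlam c hc)]
      · exact Ideal.mul_mem_left _ _ (Ideal.mul_mem_left _ _ (hGJ c (hA₀ hc)))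
    · exact ⟨monomial (Tmono v n a) 1, isWeightedHomogeneous_monomial _ _ _ (weight_Tmono a),
        eval_dehomPoint_Tmono lam a, fun h => absurd h ha⟩
  choose F hF hF1 hFJ using hlift
  beta_reduce
  rw [LamList_eq_map]
  set Q := (List.finRange v).flatMap fun i => ((List.finRange (n i + 1)).drop 1).map fun j =>
    (⟨i, j⟩ : MVar v n)
  refine isWeaklyRegular_quotient_of_forall J _ fun i hi f hf => ?_
  have hi' : i < Q.length := by simpa using hi
  have hspan : Ideal.ofList ((Q.map (linForm lam)).take i) =
      Ideal.span (linForm lam '' {q | q ∈ Q.take i}) := by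
    rw [← List.map_take, Ideal.ofList]
    congr 1
    ext x
    exact List.mem_map
  rw [hspan] at hf ⊢
  rw [List.getElem_map] at hf
  refine mem_sup_of_linForm_mul_mem lam hF hF1 hJm hHS hFJ
    (fun q hq => snd_ne_zero_of_mem (List.mem_of_mem_take hq))
    (snd_ne_zero_of_mem (List.getElem_mem hi')) (fun hmem => ?_) hf
  obtain ⟨k, hk, hk'⟩ := List.mem_take_iff_getElem.mp hmem
  have := (nodup_flatMap_drop.getElem_inj_iff).mp hk'
  omega

end
end

section
/- Let J be a Cartwright-Sturmfels* ideal of S. Then the multidegrees of the elements of any minimal system of Z^v-homogeneous generators of J are pairwise incomparable in Z^v (with respect to the componentwise partial order). -/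
open MvPolynomial

noncomputable section

open CSPaper

namespace MvPolynomial.IsWeightedHomogeneous

theorem aeval {R M σ τ : Type*} [CommSemiring R] [AddCommMonoid M] {w : σ → M} {w' : τ → M}
    {φ : σ → MvPolynomial τ R} (hφ : ∀ s, (φ s).IsWeightedHomogeneous w' (w s))
    {p : MvPolynomial σ R} {m : M} (hp : p.IsWeightedHomogeneous w m) :
    (MvPolynomial.aeval φ p).IsWeightedHomogeneous w' m := by
  rw [aeval_def, eval₂_eq]
  refine IsWeightedHomogeneous.sum _ _ _ fun d hd => ?_
  rw [← hp (mem_support_iff.mp hd), Finsupp.weight_apply]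
  exact (IsWeightedHomogeneous.prod _ _ _ fun s _ => (hφ s).pow _).C_mul _

end MvPolynomial.IsWeightedHomogeneous

namespace CSPaper

section

variable {v : ℕ} {n : Fin v → ℕ}

lemma weight_wt_apply (u : MVar v n →₀ ℕ) (i : Fin v) :
    Finsupp.weight (wt v n) u i = ∑ j, u ⟨i, j⟩ := by
  rw [Finsupp.weight_eq_sum, Fintype.sum_sigma, Finset.sum_apply, Finset.sum_eq_single i]
  · simp [wt]
  · intro k _ hk
    simp [wt, Finset.sum_apply, hk.symm]
  · simp

lemma finite_weight_wt_eq (b : Fin v → ℕ) :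
    {u : MVar v n →₀ ℕ | Finsupp.weight (wt v n) u = b}.Finite := by
  refine (Set.finite_Iic (Finsupp.equivFunOnFinite.symm fun p : MVar v n => b p.1)).subset ?_
  rintro u rfl p
  simp only [Finsupp.equivFunOnFinite_symm_apply_apply, weight_wt_apply]
  exact Finset.single_le_sum (f := fun j => u ⟨p.1, j⟩) (fun _ _ => Nat.zero_le _)
    (Finset.mem_univ p.2)

/-- The multidegree of the part of a monomial in the first variables of the rows. -/
def headDeg (u : MVar v n →₀ ℕ) : Fin v → ℕ := fun i => u ⟨i, 0⟩

/-- The part of an exponent not involving the first variables of the rows. -/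
def tailExp (u : MVar v n →₀ ℕ) : MVar v n →₀ ℕ := u.filter fun p => p.2 ≠ 0

lemma Tmono_apply_zero (a : Fin v → ℕ) (i : Fin v) : Tmono v n a ⟨i, 0⟩ = a i := by
  rw [Tmono, Finsupp.finsetSum_apply, Finset.sum_eq_single i]
  · simp
  · intro k _ hk
    rw [Finsupp.single_eq_of_ne]
    simp [hk.symm]
  · simp

lemma Tmono_apply_of_ne (a : Fin v → ℕ) {p : MVar v n} (hp : p.2 ≠ 0) : Tmono v n a p = 0 := by
  rw [Tmono, Finsupp.finsetSum_apply]
  refine Finset.sum_eq_zero fun k _ => Finsupp.single_eq_of_ne ?_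
  rintro rfl
  exact hp rfl

lemma headDeg_Tmono (a : Fin v → ℕ) : headDeg (Tmono v n a) = a :=
  funext (Tmono_apply_zero a)

lemma eq_Tmono_headDeg {u : MVar v n →₀ ℕ} (hu : ∀ p : MVar v n, p.2 ≠ 0 → u p = 0) :
    u = Tmono v n (headDeg u) := by
  ext ⟨i, j⟩
  by_cases hj : j = 0
  · subst hj
    rw [Tmono_apply_zero, headDeg]
  · rw [Tmono_apply_of_ne _ hj, hu _ hj]

lemma tailExp_add_Tmono (u : MVar v n →₀ ℕ) : tailExp u + Tmono v n (headDeg u) = u := by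
  ext ⟨i, j⟩
  by_cases hj : j = 0
  · subst hj
    simp [tailExp, Tmono_apply_zero, headDeg]
  · simp [tailExp, Tmono_apply_of_ne (p := ⟨i, j⟩) _ hj, hj]

lemma weight_Tmono (a : Fin v → ℕ) : Finsupp.weight (wt v n) (Tmono v n a) = a := by
  ext i
  rw [weight_wt_apply, Finset.sum_eq_single 0, Tmono_apply_zero]
  · exact fun j _ hj => Tmono_apply_of_ne a hj
  · simp

lemma weight_tailExp_add_headDeg (u : MVar v n →₀ ℕ) :
    Finsupp.weight (wt v n) (tailExp u) + headDeg u = Finsupp.weight (wt v n) u := by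
  conv_rhs => rw [← tailExp_add_Tmono u, map_add, weight_Tmono]

lemma headDeg_le_weight (u : MVar v n →₀ ℕ) : headDeg u ≤ Finsupp.weight (wt v n) u := by
  rw [← weight_tailExp_add_headDeg]
  exact le_add_self

lemma Tmono_le_iff (a : Fin v → ℕ) (u : MVar v n →₀ ℕ) : Tmono v n a ≤ u ↔ a ≤ headDeg u := by
  constructor
  · intro h i
    have := h ⟨i, 0⟩
    rwa [Tmono_apply_zero] at this
  · rintro h ⟨i, j⟩
    by_cases hj : j = 0
    · subst hj
      rw [Tmono_apply_zero]
      exact h i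
    · rw [Tmono_apply_of_ne _ hj]
      exact Nat.zero_le _

/-- The exponents of multidegree `b` of the monomials in the ideal extended from `T` that is
generated by the monomials with exponents in `A`. -/
def extExps (n : Fin v → ℕ) (A : Set (Fin v → ℕ)) (b : Fin v → ℕ) : Set (MVar v n →₀ ℕ) :=
  {u | Finsupp.weight (wt v n) u = b ∧ headDeg u ∈ upperClosure A}

lemma finite_extExps (A : Set (Fin v → ℕ)) (b : Fin v → ℕ) : (extExps n A b).Finite :=
  (finite_weight_wt_eq b).subset fun _ hu => hu.1

end

variable {K : Type} [Field K] {v : ℕ} {n : Fin v → ℕ}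

lemma hilb_span_Tmono (A : Set (Fin v → ℕ)) (b : Fin v → ℕ) :
    hilb (Ideal.span ((fun a => monomial (Tmono v n a) (1 : K)) '' A)) b =
      Nat.card (extExps n A b) := by
  have himage : (fun a => monomial (Tmono v n a) (1 : K)) '' A =
      (fun s => monomial s (1 : K)) '' (Tmono v n '' A) := by
    rw [Set.image_image]
  have hsub : (Submodule.restrictScalars K
      (Ideal.span ((fun a => monomial (Tmono v n a) (1 : K)) '' A)) ⊓
      weightedHomogeneousSubmodule K (wt v n) b : Submodule K (MvPolynomial (MVar v n) K)) =
      restrictSupport K (extExps n A b) := by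
    ext p
    rw [Submodule.mem_inf, Submodule.restrictScalars_mem, mem_weightedHomogeneousSubmodule,
      mem_restrictSupport_iff, himage, mem_ideal_span_monomial_image]
    simp only [Set.exists_mem_image, Tmono_le_iff]
    constructor
    · intro h u hu
      exact ⟨h.2 (mem_support_iff.mp hu), mem_upperClosure.mpr (h.1 u hu)⟩
    · intro h
      exact ⟨fun u hu => mem_upperClosure.mp (h hu).2,
        fun u hu => (h (mem_support_iff.mpr hu)).1⟩
  rw [hilb, hsub, Module.finrank_eq_nat_card_basis (basisRestrictSupport K (extExps n A b))]

instance finiteDimensional_weightedHomogeneousSubmodule (b : Fin v → ℕ) :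
    FiniteDimensional K (weightedHomogeneousSubmodule K (wt v n) b) := by
  have : Finite {u : MVar v n →₀ ℕ | Finsupp.weight (wt v n) u = b} :=
    (finite_weight_wt_eq b).to_subtype
  rw [weightedHomogeneousSubmodule_eq_finsupp_supported]
  exact Module.Finite.of_basis (basisRestrictSupport K _)

/-- If `J` has the Hilbert function of an ideal extended from `T`, then `J` is nonzero in exactly
those multidegrees `c` for which that ideal contains the monomial of `T` of multidegree `c`. -/
lemma exists_ne_zero_iff_mem_upperClosure {J : Ideal (MvPolynomial (MVar v n) K)}
    {A : Set (Fin v → ℕ)} (hJ : ∀ b, hilb J b = Nat.card (extExps n A b)) (c : Fin v → ℕ) :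
    (∃ p ∈ J, p ≠ 0 ∧ p.IsWeightedHomogeneous (wt v n) c) ↔ c ∈ upperClosure A := by
  have hfin : Finite (extExps n A c) := (finite_extExps A c).to_subtype
  have h1 : (∃ p ∈ J, p ≠ 0 ∧ p.IsWeightedHomogeneous (wt v n) c) ↔ hilb J c ≠ 0 := by
    rw [hilb, Ne, Submodule.finrank_eq_zero, Submodule.eq_bot_iff]
    simp only [Submodule.mem_inf, Submodule.restrictScalars_mem, mem_weightedHomogeneousSubmodule,
      not_forall]
    exact ⟨fun ⟨p, h1, h2, h3⟩ => ⟨p, ⟨h1, h3⟩, h2⟩, fun ⟨p, ⟨h1, h3⟩, h2⟩ => ⟨p, h1, h2, h3⟩⟩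
  rw [h1, hJ, Nat.card_ne_zero, and_iff_left hfin]
  constructor
  · rintro ⟨u, rfl, hu⟩
    exact (upperClosure A).upper (headDeg_le_weight u) hu
  · intro hc
    exact ⟨Tmono v n c, weight_Tmono c, by rwa [headDeg_Tmono]⟩

/-- The endomorphism `x_{i1} ↦ λ_{i1} x_{i1}`, `x_{ij} ↦ x_{ij} + λ_{ij} x_{i1}` for `j ≥ 2`. -/
def shear (lam : MVar v n → K) : MvPolynomial (MVar v n) K →ₐ[K] MvPolynomial (MVar v n) K :=
  aeval fun p : MVar v n => (if p.2 = 0 then 0 else X p) + C (lam p) * X ⟨p.1, 0⟩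

/-- The linear form `x_{ij} - (λ_{ij} / λ_{i1}) x_{i1}`. -/
def shearForm (lam : MVar v n → K) (p : MVar v n) : MvPolynomial (MVar v n) K :=
  X p - C (lam p / lam ⟨p.1, 0⟩) * X ⟨p.1, 0⟩

lemma isWeightedHomogeneous_X_zero (p : MVar v n) :
    (X ⟨p.1, 0⟩ : MvPolynomial (MVar v n) K).IsWeightedHomogeneous (wt v n) (wt v n p) :=
  isWeightedHomogeneous_X K (wt v n) ⟨p.1, 0⟩

lemma isWeightedHomogeneous_shearForm (lam : MVar v n → K) (p : MVar v n) :
    (shearForm lam p).IsWeightedHomogeneous (wt v n) (wt v n p) :=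
  (isWeightedHomogeneous_X K _ p).sub ((isWeightedHomogeneous_X_zero p).C_mul _)

lemma isWeightedHomogeneous_shear (lam : MVar v n → K) {f : MvPolynomial (MVar v n) K}
    {c : Fin v → ℕ} (hf : f.IsWeightedHomogeneous (wt v n) c) :
    (shear lam f).IsWeightedHomogeneous (wt v n) c := by
  refine hf.aeval fun p => .add ?_ ((isWeightedHomogeneous_X_zero p).C_mul _)
  split_ifs
  · exact isWeightedHomogeneous_zero K _ _
  · exact isWeightedHomogeneous_X K _ p

lemma shear_shearForm {lam : MVar v n → K} {p : MVar v n} (hp : p.2 ≠ 0)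
    (h0 : lam ⟨p.1, 0⟩ ≠ 0) : shear lam (shearForm lam p) = X p := by
  have h : (C (lam p / lam ⟨p.1, 0⟩) * C (lam ⟨p.1, 0⟩) : MvPolynomial (MVar v n) K) =
      C (lam p) := by
    rw [← C_mul, div_mul_cancel₀ _ h0]
  simp only [shearForm, shear, map_sub, map_mul, aeval_X, algHom_C, hp, if_false, if_true,
    zero_add, algebraMap_eq]
  rw [← mul_assoc, h, add_sub_cancel_right]

lemma shear_aeval_shearForm {lam : MVar v n → K} (h0 : ∀ i, lam ⟨i, 0⟩ ≠ 0)
    (u : MVar v n →₀ ℕ) :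
    shear lam (aeval (shearForm lam) (monomial (tailExp u) (1 : K))) =
      monomial (tailExp u) 1 := by
  rw [aeval_monomial, map_one, one_mul, monomial_eq, C_1, one_mul, Finsupp.prod, Finsupp.prod,
    map_prod]
  refine Finset.prod_congr rfl fun p hp => ?_
  have hp : p.2 ≠ 0 := by
    rw [tailExp, Finsupp.support_filter, Finset.mem_filter] at hp
    exact hp.2
  rw [map_pow, shear_shearForm hp (h0 _)]

lemma eval_shear (lam : MVar v n → K) (f : MvPolynomial (MVar v n) K) :
    eval (fun p : MVar v n => if p.2 = 0 then 1 else 0) (shear lam f) = eval lam f := by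
  have : (aeval (fun p : MVar v n => if p.2 = 0 then (1 : K) else 0)).comp (shear lam) =
      aeval lam := by
    ext p
    by_cases hp : p.2 = 0 <;> simp [shear, hp]
  simpa using DFunLike.congr_fun this f

lemma coeff_shear_ne_zero {lam : MVar v n → K} {f : MvPolynomial (MVar v n) K}
    {c : Fin v → ℕ} (hf : f.IsWeightedHomogeneous (wt v n) c) (h : eval lam f ≠ 0) :
    coeff (Tmono v n c) (shear lam f) ≠ 0 := by
  rw [← eval_shear, eval_eq] at h
  obtain ⟨d, hd, hne⟩ := Finset.exists_ne_zero_of_sum_ne_zero h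
  have hd0 : ∀ p : MVar v n, p.2 ≠ 0 → d p = 0 := by
    intro p hp
    by_contra hdp
    refine hne (mul_eq_zero_of_right _ (Finset.prod_eq_zero (Finsupp.mem_support_iff.mpr hdp) ?_))
    simp [hp, hdp]
  have hdT := eq_Tmono_headDeg hd0
  have hw := isWeightedHomogeneous_shear lam hf (mem_support_iff.mp hd)
  rw [hdT, weight_Tmono] at hw
  rw [← hw, ← hdT]
  exact mem_support_iff.mp hd

/-- Products of monomials in the variables `x_{ij}`, `j ≥ 2`, with polynomials involving a
specified monomial of `T` are linearly independent when the products are of the same degree. -/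
lemma linearIndependent_monomial_mul {U : Set (MVar v n →₀ ℕ)} {b : Fin v → ℕ}
    (hU : ∀ u ∈ U, Finsupp.weight (wt v n) u = b) {q : (Fin v → ℕ) → MvPolynomial (MVar v n) K}
    (hq : ∀ u ∈ U, coeff (Tmono v n (headDeg u)) (q (headDeg u)) ≠ 0) :
    LinearIndependent K fun u : U => monomial (tailExp (u : MVar v n →₀ ℕ)) (1 : K) *
      q (headDeg (u : MVar v n →₀ ℕ)) := by
  classical
  rw [linearIndependent_iff']
  intro s k hk
  by_contra! hne
  obtain ⟨u₀, hu₀s, hu₀⟩ := hne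
  obtain ⟨u, hu, hmin⟩ := Finset.exists_min_image (s.filter fun u => k u ≠ 0)
    (fun u => (tailExp (u : MVar v n →₀ ℕ)).degree) ⟨u₀, by simp [hu₀s, hu₀]⟩
  rw [Finset.mem_filter] at hu
  have hc := congrArg (coeff (u : MVar v n →₀ ℕ)) hk
  rw [coeff_sum, coeff_zero, Finset.sum_eq_single u] at hc
  · rw [coeff_smul, coeff_monomial_mul', if_pos, one_mul, smul_eq_mul] at hc
    · refine mul_ne_zero hu.2 (hq u u.2) ?_
      rwa [tsub_eq_of_eq_add_rev (tailExp_add_Tmono (u : MVar v n →₀ ℕ)).symm] at hc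
    · exact le_self_add.trans_eq (tailExp_add_Tmono _)
  · intro w hw hwu
    by_cases hkw : k w = 0
    · rw [hkw, zero_smul, coeff_zero]
    rw [coeff_smul, coeff_monomial_mul', if_neg, smul_zero]
    intro hle
    have htail : tailExp (w : MVar v n →₀ ℕ) ≤ tailExp (u : MVar v n →₀ ℕ) := by
      intro p
      by_cases hp : p.2 = 0
      · simp [tailExp, hp]
      · have := hle p
        simpa [tailExp, hp] using this
    obtain ⟨d, hd⟩ := exists_add_of_le htail
    have hdeg := hmin w (Finset.mem_filter.mpr ⟨hw, hkw⟩)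
    rw [hd, map_add, add_le_iff_nonpos_right, nonpos_iff_eq_zero, Finsupp.degree_eq_zero_iff]
      at hdeg
    rw [hdeg, add_zero] at hd
    have hweight := (hU w w.2).trans (hU u u.2).symm
    rw [← weight_tailExp_add_headDeg (u : MVar v n →₀ ℕ), hd,
      ← weight_tailExp_add_headDeg (w : MVar v n →₀ ℕ), add_right_inj] at hweight
    refine hwu (Subtype.ext ?_)
    rw [← tailExp_add_Tmono (w : MVar v n →₀ ℕ), ← hd, hweight, tailExp_add_Tmono]
  · exact fun h => absurd hu.1 h

lemma isWeightedHomogeneous_aeval_shearForm_mul (lam : MVar v n → K) {u : MVar v n →₀ ℕ}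
    {f : MvPolynomial (MVar v n) K} (hf : f.IsWeightedHomogeneous (wt v n) (headDeg u)) :
    (aeval (shearForm lam) (monomial (tailExp u) (1 : K)) * f).IsWeightedHomogeneous (wt v n)
      (Finsupp.weight (wt v n) u) := by
  rw [← weight_tailExp_add_headDeg]
  exact .mul (.aeval (isWeightedHomogeneous_shearForm lam)
    (isWeightedHomogeneous_monomial _ _ _ rfl)) hf

lemma aeval_shearForm_mem_ker (lam : MVar v n → K) {u : MVar v n →₀ ℕ} (hu : u ≠ 0) :
    aeval (shearForm lam) (monomial u (1 : K)) ∈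
      RingHom.ker (constantCoeff : MvPolynomial (MVar v n) K →+* K) := by
  obtain ⟨p, hp⟩ := Finsupp.support_nonempty_iff.mpr hu
  rw [RingHom.mem_ker, aeval_monomial, map_one, one_mul, Finsupp.prod, map_prod]
  refine Finset.prod_eq_zero hp ?_
  rw [map_pow]
  have : constantCoeff (shearForm lam p) = 0 := by simp [shearForm]
  rw [this, zero_pow (Finsupp.mem_support_iff.mp hp)]

/-- There is a point with nonzero coordinates at which finitely many nonzero polynomials do not
vanish. -/
lemma exists_eval_ne_zero {σ ι : Type*} [Finite σ] [Infinite K] {s : Set ι} (hs : s.Finite)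
    {f : ι → MvPolynomial σ K} (hf : ∀ i ∈ s, f i ≠ 0) :
    ∃ lam : σ → K, (∀ x, lam x ≠ 0) ∧ ∀ i ∈ s, eval lam (f i) ≠ 0 := by
  have := Fintype.ofFinite σ
  have hne : (∏ i ∈ hs.toFinset, f i) * ∏ x : σ, X x ≠ 0 :=
    mul_ne_zero (Finset.prod_ne_zero_iff.mpr fun i hi => hf i (hs.mem_toFinset.mp hi))
      (Finset.prod_ne_zero_iff.mpr fun x _ => X_ne_zero x)
  obtain ⟨lam, hlam⟩ : ∃ lam, eval lam ((∏ i ∈ hs.toFinset, f i) * ∏ x : σ, X x) ≠ 0 := by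
    by_contra! h
    exact hne (MvPolynomial.funext fun x => by rw [h, map_zero])
  rw [map_mul, map_prod, map_prod, mul_ne_zero_iff, Finset.prod_ne_zero_iff,
    Finset.prod_ne_zero_iff] at hlam
  exact ⟨lam, fun x => by simpa using hlam.2 x (Finset.mem_univ x),
    fun i hi => hlam.1 i (hs.mem_toFinset.mpr hi)⟩

/-- If `J` has the Hilbert function of an ideal extended from `T` and `J` is nonzero in some
multidegree below `b`, then every element of `J` of multidegree `b` is a combination of elements
of `J` with coefficients in the irrelevant maximal ideal. -/
lemma mem_ker_constantCoeff_mul [Infinite K] {J : Ideal (MvPolynomial (MVar v n) K)}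
    {A : Set (Fin v → ℕ)} (hJ : ∀ b, hilb J b = Nat.card (extExps n A b))
    {a b : Fin v → ℕ} (hab : a < b) {f g : MvPolynomial (MVar v n) K} (hfJ : f ∈ J) (hf0 : f ≠ 0)
    (hf : f.IsWeightedHomogeneous (wt v n) a) (hgJ : g ∈ J)
    (hg : g.IsWeightedHomogeneous (wt v n) b) :
    g ∈ RingHom.ker (constantCoeff : MvPolynomial (MVar v n) K →+* K) * J := by
  set M := RingHom.ker (constantCoeff : MvPolynomial (MVar v n) K →+* K)
  have hchoice : ∀ c, ∃ p : MvPolynomial (MVar v n) K, c ∈ upperClosure A →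
      p ∈ J ∧ p ≠ 0 ∧ p.IsWeightedHomogeneous (wt v n) c ∧ (c = b → p ∈ M * J) := by
    intro c
    by_cases hc : c ∈ upperClosure A
    swap
    · exact ⟨0, fun h => absurd h hc⟩
    by_cases hcb : c = b
    · subst hcb
      have ha := (exists_ne_zero_iff_mem_upperClosure hJ a).mp ⟨f, hfJ, hf0, hf⟩
      obtain ⟨hle, i, hi⟩ := Pi.lt_def.mp hab
      have hsingle : Pi.single i 1 ≤ c := by
        intro k
        by_cases hk : k = i
        · subst hk
          simp only [Pi.single_eq_same]
          omega
        · simp [hk]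
      have hale : a ≤ c - Pi.single i 1 := by
        intro k
        by_cases hk : k = i
        · subst hk
          simp only [Pi.sub_apply, Pi.single_eq_same]
          omega
        · simpa [hk] using hle k
      obtain ⟨p, hpJ, hp0, hp⟩ := (exists_ne_zero_iff_mem_upperClosure hJ _).mpr
        ((upperClosure A).upper hale ha)
      have hmul : X (⟨i, 0⟩ : MVar v n) * p ∈ M * J :=
        Ideal.mul_mem_mul (by rw [RingHom.mem_ker, constantCoeff_X]) hpJ
      refine ⟨X (⟨i, 0⟩ : MVar v n) * p, fun _ => ⟨J.mul_mem_left _ hpJ, mul_ne_zero (X_ne_zero _) hp0, ?_,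
        fun _ => hmul⟩⟩
      have hX : (X (⟨i, 0⟩ : MVar v n) : MvPolynomial (MVar v n) K).IsWeightedHomogeneous
          (wt v n) (Pi.single i 1) := isWeightedHomogeneous_X K _ _
      rw [← add_tsub_cancel_of_le hsingle]
      exact hX.mul hp
    · obtain ⟨p, h1, h2, h3⟩ := (exists_ne_zero_iff_mem_upperClosure hJ c).mpr hc
      exact ⟨p, fun _ => ⟨h1, h2, h3, fun h => absurd h hcb⟩⟩
  choose F hF using hchoice
  have hfin := finite_extExps (n := n) A b
  have := hfin.fintype
  obtain ⟨lam, hlam, hev⟩ := exists_eval_ne_zero hfin (f := fun u => F (headDeg u))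
    fun u hu => (hF _ hu.2).2.1
  let B : extExps n A b → MvPolynomial (MVar v n) K := fun u =>
    aeval (shearForm lam) (monomial (tailExp (u : MVar v n →₀ ℕ)) (1 : K)) *
      F (headDeg (u : MVar v n →₀ ℕ))
  have hB : LinearIndependent K B := by
    refine LinearIndependent.of_comp (shear lam).toLinearMap ?_
    have hcomp : (shear lam).toLinearMap ∘ B = fun u : extExps n A b =>
        monomial (tailExp (u : MVar v n →₀ ℕ)) (1 : K) *
          shear lam (F (headDeg (u : MVar v n →₀ ℕ))) := by
      funext u
      simp only [B, Function.comp_apply, AlgHom.toLinearMap_apply, map_mul,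
        shear_aeval_shearForm fun i => hlam ⟨i, 0⟩]
    rw [hcomp]
    exact linearIndependent_monomial_mul (fun u hu => hu.1) (q := fun c => shear lam (F c))
      fun u hu => coeff_shear_ne_zero (hF _ hu.2).2.2.1 (hev u hu)
  have hspan : Submodule.span K (Set.range B) = Submodule.restrictScalars K J ⊓
      weightedHomogeneousSubmodule K (wt v n) b := by
    have : FiniteDimensional K ((Submodule.restrictScalars K J ⊓
      weightedHomogeneousSubmodule K (wt v n) b : Submodule K (MvPolynomial (MVar v n) K))) :=
      Submodule.finiteDimensional_inf_right _ _
    refine Submodule.eq_of_le_of_finrank_eq ?_ ?_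
    · rw [Submodule.span_le]
      rintro _ ⟨u, rfl⟩
      refine ⟨J.mul_mem_left _ (hF _ u.2.2).1, ?_⟩
      rw [SetLike.mem_coe, mem_weightedHomogeneousSubmodule, ← u.2.1]
      exact isWeightedHomogeneous_aeval_shearForm_mul lam (hF _ u.2.2).2.2.1
    · rw [finrank_span_eq_card hB, ← Nat.card_eq_fintype_card, ← hJ b, hilb]
  have hgspan : g ∈ Submodule.span K (Set.range B) := by
    rw [hspan]
    exact ⟨hgJ, hg⟩
  refine (Submodule.span_le (p := Submodule.restrictScalars K (M * J))).mpr ?_ hgspan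
  rintro _ ⟨⟨u, hu⟩, rfl⟩
  by_cases htail : tailExp u = 0
  · have hhead := weight_tailExp_add_headDeg u
    rw [htail, map_zero, zero_add, hu.1] at hhead
    exact (M * J).mul_mem_left _ ((hF _ hu.2).2.2.2 hhead)
  · exact Ideal.mul_mem_mul (aeval_shearForm_mem_ker lam htail) (hF _ hu.2).1

lemma mem_of_mem_sup_ker_mul_span_singleton {I : Ideal (MvPolynomial (MVar v n) K)}
    (hI : IsMultigraded I) {g : MvPolynomial (MVar v n) K} {b : Fin v → ℕ}
    (hg : g.IsWeightedHomogeneous (wt v n) b)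
    (h : g ∈ I ⊔ RingHom.ker (constantCoeff : MvPolynomial (MVar v n) K →+* K) *
      Ideal.span {g}) : g ∈ I := by
  classical
  let := weightedGradedAlgebra K (wt v n)
  obtain ⟨x, hx, y, hy, hxy⟩ := Submodule.mem_sup.mp h
  obtain ⟨q, hq, rfl⟩ := Ideal.mem_mul_span_singleton.mp hy
  rw [RingHom.mem_ker, constantCoeff_eq] at hq
  have hqg : weightedHomogeneousComponent (wt v n) b (q * g) = 0 := by
    have hmul := DirectSum.coe_decompose_mul_add_of_right_mem
      (weightedHomogeneousSubmodule K (wt v n)) (i := 0) (a := q)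
      ((mem_weightedHomogeneousSubmodule K _ _ _).mpr hg)
    have hq0 : weightedHomogeneousComponent (wt v n) 0 q = 0 := by
      rw [weightedHomogeneousComponent_zero, hq, C_0]
      intro p hp
      simpa [wt] using congrFun hp p.1
    rw [zero_add] at hmul
    refine (weightedDecomposition.decompose'_apply K (wt v n) _ _).symm.trans (hmul.trans ?_)
    rw [← zero_mul g, ← hq0]
    exact congrArg (· * g) (weightedDecomposition.decompose'_apply K (wt v n) _ _)
  have hcomp := congrArg (weightedHomogeneousComponent (wt v n) b) hxy
  rw [map_add, hqg, add_zero, hg.weightedHomogeneousComponent_same] at hcomp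
  exact hcomp ▸ hI x hx b

lemma isMultigraded_span {G : Set (MvPolynomial (MVar v n) K)}
    (hG : ∀ f ∈ G, ∃ a : Fin v → ℕ, f.IsWeightedHomogeneous (wt v n) a) :
    IsMultigraded (Ideal.span G) := by
  classical
  let := weightedGradedAlgebra K (wt v n)
  intro f hf a
  refine weightedHomogeneousComponent_mem_of_mem K (wt v n) (Ideal.homogeneous_span _ _ ?_) hf a
  intro x hx
  obtain ⟨c, hc⟩ := hG x hx
  exact ⟨c, hc⟩

end CSPaper

/-- **Proposition (4) on CS* ideals.** The multidegrees of the elements of any minimal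
system of `ℤ^v`-homogeneous generators of a Cartwright-Sturmfels* ideal are pairwise
incomparable in `ℤ^v` (componentwise order): if `a ≤ b` are multidegrees of two minimal
generators then `a = b`. -/
theorem CSstar_incomparable_degrees
    {K : Type} [Field K] [Infinite K] {v : ℕ} {n : Fin v → ℕ}
    (J : Ideal (MvPolynomial (MVar v n) K)) (hJ : IsCSstar J)
    (G : Set (MvPolynomial (MVar v n) K))
    (hGhom : ∀ f ∈ G, f ≠ 0 ∧ ∃ a : Fin v → ℕ, f.IsWeightedHomogeneous (wt v n) a)
    (hGgen : Ideal.span G = J)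
    (hGmin : ∀ f ∈ G, f ∉ Ideal.span (G \ {f})) :
    ∀ f ∈ G, ∀ g ∈ G, ∀ a b : Fin v → ℕ,
      f.IsWeightedHomogeneous (wt v n) a → g.IsWeightedHomogeneous (wt v n) b →
      a ≤ b → a = b := by
  obtain ⟨-, _, ⟨A, rfl⟩, hHS⟩ := hJ
  intro f hf g hg a b hfa hgb hab
  by_contra hne
  have hJA : ∀ b, hilb J b = Nat.card (extExps n A b) := fun b =>
    (hHS b).trans (hilb_span_Tmono A b)
  have hGJ : G ⊆ J := hGgen ▸ Ideal.subset_span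
  have hmem := mem_ker_constantCoeff_mul hJA (lt_of_le_of_ne hab hne) (hGJ hf) (hGhom f hf).1 hfa
    (hGJ hg) hgb
  have hsplit : J = Ideal.span (G \ {g}) ⊔ Ideal.span {g} := by
    rw [← Ideal.span_union, Set.sdiff_union_of_subset (Set.singleton_subset_iff.mpr hg), hGgen]
  rw [hsplit, Ideal.mul_sup] at hmem
  have hle : RingHom.ker (constantCoeff : MvPolynomial (MVar v n) K →+* K) *
      Ideal.span (G \ {g}) ⊔ RingHom.ker constantCoeff * Ideal.span {g} ≤
      Ideal.span (G \ {g}) ⊔ RingHom.ker constantCoeff * Ideal.span {g} :=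
    sup_le_sup_right Ideal.mul_le_right _
  exact hGmin g hg (mem_of_mem_sup_ker_mul_span_singleton
    (isMultigraded_span fun x hx => (hGhom x hx.1).2) hgb
    (hle hmem))

end
end
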